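/- There exists an instance I(X,R) of the Index Coding problem such that: (i) I has a (not necessarily linear) (2,4) index code of length 2·μ(I), so the optimal rate satisfies λ(2,4) = μ(I); and (ii) for every prime power q and every positive integer n, every linear (n,q) index code for I over F_q has length strictly greater than n·μ(I). Consequently, vector linear index codes are insufficient: non-linear index codes can strictly outperform linear index codes over every field and every block length. -/

import Mathlib

/-- `mu R` is the maximum, over side-information sets `H`, of the number of distinct
messages demanded by clients of `R` whose side-information set equals `H`. -/
def mu {ι : Type} [DecidableEq ι] (R : Finset (ι × Finset ι)) : ℕ :=
  (R.image Prod.snd).sup fun H => ((R.filter fun r => r.2 = H).image Prod.fst).card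

/-- `f` is an index code of block length `n` and length `ℓ` for the instance with
clients `R`: every client `(i, H) ∈ R` can decode message `i` from the broadcast
`f X` together with the messages indexed by `H`. -/
def IsIndexCode {ι A : Type} (R : Finset (ι × Finset ι)) (n ℓ : ℕ)
    (f : (ι → Fin n → A) → Fin ℓ → A) : Prop :=
  ∀ r ∈ R, ∀ X X' : ι → Fin n → A,
    f X = f X' → (∀ j ∈ r.2, X j = X' j) → X r.1 = X' r.1

/-- Clients on messages `0, b, c, w, x, y, z` imposing the relations common to the Fano and
non-Fano matroids, where `w`, `x`, `y`, `z` stand for `0 + b`, `0 + c`, `b + c`, `0 + b + c`. -/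
def fanoClients (b c w x y z : Fin 19) : Finset (Fin 19 × Finset (Fin 19)) :=
  {(0, {z, b, c}), (b, {z, 0, c}), (c, {z, 0, b}), (w, {0, b}), (x, {0, c}), (y, {b, c}),
    (w, {z, c}), (x, {z, b}), (y, {z, 0}), (0, {w, b})}

/-- The clients demanding each of the messages `7, …, 18` with side information `0, …, 6`. -/
def edgeClients : Finset (Fin 19 × Finset (Fin 19)) :=
  Finset.univ.image fun e : Fin 12 => (e.natAdd 7, {0, 1, 2, 3, 4, 5, 6})

/-- Two non-Fano blocks, decoded jointly, and a Fano block, all sharing message `0`. -/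
def clients : Finset (Fin 19 × Finset (Fin 19)) :=
  edgeClients ∪ fanoClients 1 2 7 8 9 10 ∪ fanoClients 3 4 11 12 13 14 ∪
    fanoClients 5 6 15 16 17 18 ∪ {(0, {7, 8, 9, 11, 12, 13}), (15, {16, 17})}

theorem mu_clients : mu clients = 12 := by decide +kernel

theorem clients_notMem : ∀ r ∈ clients, r.1 ∉ r.2 :=
  Finset.filter_eq_empty_iff.mp (by decide +kernel : {r ∈ clients | r.1 ∈ r.2} = ∅)

/-- Exchange of the two binary digits. -/
def swapBits : Fin 4 → Fin 4 := ![0, 2, 1, 3]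

theorem swapBits_injective : Function.Injective swapBits := by decide

theorem eq_of_add_self_eq {a a' : Fin 4} (h : a + a = a' + a')
    (h' : swapBits a + swapBits a = swapBits a' + swapBits a') : a = a' := by
  revert a a'; decide

/-- The symbols computed from the sources `0, …, 6`: the first non-Fano block uses
addition modulo `4`, the second does so after exchanging the digits of message `0`, and the
Fano block uses bitwise addition. -/
def networkSymbols (x : Fin 19 → Fin 4) : Fin 19 → Fin 4 :=
  ![x 0, x 1, x 2, x 3, x 4, x 5, x 6,
    x 0 + x 1, x 0 + x 2, x 1 + x 2, x 0 + x 1 + x 2,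
    swapBits (x 0) + x 3, swapBits (x 0) + x 4, x 3 + x 4, swapBits (x 0) + x 3 + x 4,
    x 0 ^^^ x 5, x 0 ^^^ x 6, x 5 ^^^ x 6, x 0 ^^^ x 5 ^^^ x 6]

/-- In a commutative cancellative semigroup the relations of `fanoClients` hold. -/
theorem eq_of_mem_fanoClients {op : Fin 4 → Fin 4 → Fin 4} (hcomm : ∀ a b, op a b = op b a)
    (hassoc : ∀ a b c, op (op a b) c = op a (op b c)) (hcancel : ∀ a b c, op a b = op a c → b = c)
    {t : Fin 4 → Fin 4} (ht : Function.Injective t) {b c w x y z : Fin 19}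
    {S S' : Fin 19 → Fin 4}
    (hS : ∀ T ∈ [S, S'], T w = op (t (T 0)) (T b) ∧ T x = op (t (T 0)) (T c) ∧
      T y = op (T b) (T c) ∧ T z = op (op (t (T 0)) (T b)) (T c))
    {r : Fin 19 × Finset (Fin 19)} (hr : r ∈ fanoClients b c w x y z)
    (h : ∀ i ∈ r.2, S i = S' i) : S r.1 = S' r.1 := by
  have hcancel' : ∀ a b c, op b a = op c a → b = c := fun a b c h =>
    hcancel a b c (by rw [hcomm a b, hcomm a c, h])
  obtain ⟨w1, x1, y1, z1⟩ := hS S (by simp)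
  obtain ⟨w2, x2, y2, z2⟩ := hS S' (by simp)
  have z3 : ∀ a b c, op (op a b) c = op (op a c) b := fun a b c => by
    rw [hassoc, hcomm b c, hassoc]
  simp only [fanoClients, Finset.mem_insert, Finset.mem_singleton] at hr
  rcases hr with rfl | rfl | rfl | rfl | rfl | rfl | rfl | rfl | rfl | rfl <;>
    simp only [Finset.mem_insert, Finset.mem_singleton, forall_eq_or_imp, forall_eq] at h ⊢
  · obtain ⟨hz, hb, hc⟩ := h
    rw [z1, z2, hb, hc] at hz
    exact ht (hcancel' _ _ _ (hcancel' _ _ _ hz))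
  · obtain ⟨hz, ha, hc⟩ := h
    rw [z1, z2, ha, hc] at hz
    exact hcancel _ _ _ (hcancel' _ _ _ hz)
  · obtain ⟨hz, ha, hb⟩ := h
    rw [z1, z2, ha, hb] at hz
    exact hcancel _ _ _ hz
  · rw [w1, w2, h.1, h.2]
  · rw [x1, x2, h.1, h.2]
  · rw [y1, y2, h.1, h.2]
  · obtain ⟨hz, hc⟩ := h
    rw [z1, z2, hc] at hz
    rw [w1, w2]
    exact hcancel' _ _ _ hz
  · obtain ⟨hz, hb⟩ := h
    rw [z1, z2, hb, z3, z3 _ _ (S' c)] at hz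
    rw [x1, x2]
    exact hcancel' _ _ _ hz
  · obtain ⟨hz, ha⟩ := h
    rw [z1, z2, ha, hassoc, hassoc] at hz
    rw [y1, y2]
    exact hcancel _ _ _ hz
  · obtain ⟨hw, hb⟩ := h
    rw [w1, w2, hb] at hw
    exact ht (hcancel' _ _ _ hw)

theorem networkSymbols_eq {x x' : Fin 19 → Fin 4} {r : Fin 19 × Finset (Fin 19)}
    (hr : r ∈ clients) (h : ∀ i ∈ r.2, networkSymbols x i = networkSymbols x' i) :
    networkSymbols x r.1 = networkSymbols x' r.1 := by
  simp only [clients, Finset.mem_union, or_assoc] at hr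
  rcases hr with hr | hr | hr | hr | hr
  · obtain ⟨e, -, rfl⟩ := Finset.mem_image.mp hr
    simp only [Finset.mem_insert, Finset.mem_singleton, forall_eq_or_imp, forall_eq] at h
    obtain ⟨h0, h1, h2, h3, h4, h5, h6⟩ := h
    change x 0 = x' 0 at h0
    change x 1 = x' 1 at h1
    change x 2 = x' 2 at h2
    change x 3 = x' 3 at h3
    change x 4 = x' 4 at h4
    change x 5 = x' 5 at h5
    change x 6 = x' 6 at h6
    rw [networkSymbols, networkSymbols, h0, h1, h2, h3, h4, h5, h6]
  · exact eq_of_mem_fanoClients (op := (· + ·)) (t := id) (by decide) (by decide) (by decide)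
      Function.injective_id (by simp [networkSymbols]) hr h
  · exact eq_of_mem_fanoClients (op := (· + ·)) (t := swapBits) (by decide) (by decide)
      (by decide) swapBits_injective (by simp [networkSymbols]) hr h
  · exact eq_of_mem_fanoClients (op := (· ^^^ ·)) (t := id) (by decide) (by decide) (by decide)
      Function.injective_id (by simp [networkSymbols]) hr h
  · have add_self : ∀ {a b c a' b' c' : Fin 4}, a + b = a' + b' → a + c = a' + c' →
        b + c = b' + c' → a + a = a' + a' := by
      intro a b c a' b' c' hab hac hbc
      have key : ∀ a b c : Fin 4, a + a = (a + b) + (a + c) - (b + c) := by decide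
      rw [key a b c, key a' b' c', hab, hac, hbc]
    simp only [Finset.mem_insert, Finset.mem_singleton] at hr
    rcases hr with rfl | rfl
    · simp only [Finset.mem_insert, Finset.mem_singleton, forall_eq_or_imp, forall_eq] at h
      obtain ⟨h7, h8, h9, h11, h12, h13⟩ := h
      exact eq_of_add_self_eq (add_self h7 h8 h9) (add_self h11 h12 h13)
    · simp only [Finset.mem_insert, Finset.mem_singleton, forall_eq_or_imp, forall_eq] at h
      have key : ∀ a b c : Fin 4, a ^^^ b = (a ^^^ c) ^^^ (b ^^^ c) := by decide
      change x 0 ^^^ x 5 = x' 0 ^^^ x' 5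
      rw [key (x 0) (x 5) (x 6), key (x' 0) (x' 5) (x' 6)]
      exact congrArg₂ _ h.1 h.2

theorem exists_isIndexCode_clients :
    ∃ g : (Fin 19 → Fin 2 → Fin 4) → Fin (2 * 12) → Fin 4, IsIndexCode clients 2 (2 * 12) g := by
  refine ⟨fun X k => X ((finProdFinEquiv.symm k).2.natAdd 7) (finProdFinEquiv.symm k).1 +
    networkSymbols (X · (finProdFinEquiv.symm k).1) ((finProdFinEquiv.symm k).2.natAdd 7), ?_⟩
  intro r hr X X' hg h
  have hedge (i : Fin 2) (e : Fin 12) :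
      X (e.natAdd 7) i + networkSymbols (X · i) (e.natAdd 7) =
        X' (e.natAdd 7) i + networkSymbols (X' · i) (e.natAdd 7) := by
    simpa using congrFun hg (finProdFinEquiv (i, e))
  have hsource (Y : Fin 19 → Fin 2 → Fin 4) (i : Fin 2) (s : Fin 7) :
      networkSymbols (Y · i) (s.castAdd 12) = Y (s.castAdd 12) i := by
    fin_cases s <;> rfl
  have hiff (i : Fin 2) (p : Fin 19) :
      networkSymbols (X · i) p = networkSymbols (X' · i) p ↔ X p i = X' p i := by
    induction p using Fin.addCases (m := 7) (n := 12) with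
    | left s => rw [hsource, hsource]
    | right e =>
      have := hedge i e
      constructor <;> intro h <;> rw [h] at this
      · exact add_right_cancel this
      · exact add_left_cancel this
  funext i
  exact (hiff i r.1).mp (networkSymbols_eq hr fun p hp => (hiff i p).mpr (congrFun (h p hp) i))

/-- `(s, t, r)` extends any `s` to a common kernel vector of `x` and `y`, on which `w` behaves as
on `(2s, 0, ·)`. -/
theorem exists_kernel_of_fano_relations {F V W : Type*} [Field F] [AddCommGroup V] [Module F V]
    [AddCommGroup W] [Module F W] [FiniteDimensional F W] {a b c w x y z : V →ₗ[F] W}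
    (hsurj : ∀ s t r, ∃ X, a X = s ∧ b X = t ∧ c X = r)
    (hb : ∀ X, z X = 0 → a X = 0 → c X = 0 → b X = 0)
    (hc : ∀ X, z X = 0 → a X = 0 → b X = 0 → c X = 0)
    (hw : ∀ X, a X = 0 → b X = 0 → w X = 0)
    (hx : ∀ X, a X = 0 → c X = 0 → x X = 0)
    (hy : ∀ X, b X = 0 → c X = 0 → y X = 0)
    (hzw : ∀ X, z X = 0 → c X = 0 → w X = 0)
    (hzx : ∀ X, z X = 0 → b X = 0 → x X = 0)
    (hzy : ∀ X, z X = 0 → a X = 0 → y X = 0) (s : W) :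
    ∃ t r, ∀ X, a X = s → b X = t → c X = r →
      x X = 0 ∧ y X = 0 ∧ ∀ Y, a Y = s + s → b Y = 0 → w X = w Y := by
  obtain ⟨σ, hσ⟩ := (a.prod (b.prod c)).exists_rightInverse_of_surjective <|
    LinearMap.range_eq_top.mpr fun ⟨s, t, r⟩ => by
      obtain ⟨X, rfl, rfl, rfl⟩ := hsurj s t r
      exact ⟨X, rfl⟩
  have hσ' (p : W × W × W) : a (σ p) = p.1 ∧ b (σ p) = p.2.1 ∧ c (σ p) = p.2.2 := by
    have h : (a (σ p), b (σ p), c (σ p)) = p := LinearMap.congr_fun hσ p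
    rw [Prod.ext_iff, Prod.ext_iff] at h
    exact h
  have σa p := (hσ' p).1
  have σb p := (hσ' p).2.1
  have σc p := (hσ' p).2.2
  have hinj_b : Function.Injective (z ∘ₗ σ ∘ₗ LinearMap.inr F W (W × W) ∘ₗ LinearMap.inl F W W) :=
    (injective_iff_map_eq_zero _).mpr fun t ht => by
      simpa [σb] using hb _ ht (by simp [σa]) (by simp [σc])
  have hinj_c : Function.Injective (z ∘ₗ σ ∘ₗ LinearMap.inr F W (W × W) ∘ₗ LinearMap.inr F W W) :=
    (injective_iff_map_eq_zero _).mpr fun r hr => by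
      simpa [σc] using hc _ hr (by simp [σa]) (by simp [σb])
  obtain ⟨t, ht⟩ := LinearMap.surjective_of_injective hinj_b (z (σ (s, 0, 0)))
  obtain ⟨r, hr⟩ := LinearMap.surjective_of_injective hinj_c (z (σ (s, 0, 0)))
  simp only [LinearMap.comp_apply, LinearMap.inr_apply, LinearMap.inl_apply] at ht hr
  refine ⟨t, -r, fun X hXa hXb hXc => ⟨?_, ?_, fun Y hYa hYb => ?_⟩⟩
  · have h₁ := hx (X - (σ (s, 0, 0) - σ (0, 0, r))) (by simp [σa, hXa]) (by simp [σc, hXc])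
    have h₂ := hzx (σ (s, 0, 0) - σ (0, 0, r)) (by simp [hr]) (by simp [σb])
    rwa [map_sub, h₂, sub_zero] at h₁
  · have h₁ := hy (X - (σ (0, t, 0) - σ (0, 0, r))) (by simp [σb, hXb]) (by simp [σc, hXc])
    have h₂ := hzy (σ (0, t, 0) - σ (0, 0, r)) (by simp [ht, hr]) (by simp [σa])
    rwa [map_sub, h₂, sub_zero] at h₁
  · have h₁ := hw (X - Y + (σ (s, 0, 0) - σ (0, t, 0))) (by simp [σa, hXa, hYa])
      (by simp [σb, hXb, hYb])
    have h₂ := hzw (σ (s, 0, 0) - σ (0, t, 0)) (by simp [ht]) (by simp [σc])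
    rw [map_add, h₂, add_zero, map_sub] at h₁
    exact sub_eq_zero.mp h₁

section LinearCodes

variable {F : Type} [Field F] {n ℓ : ℕ} {g : (Fin 19 → Fin n → F) →ₗ[F] Fin ℓ → F}

theorem IsIndexCode.eq_zero {R : Finset (Fin 19 × Finset (Fin 19))} (hg : IsIndexCode R n ℓ g)
    {p : Fin 19} {H : Finset (Fin 19)} (hr : (p, H) ∈ R) {X : Fin 19 → Fin n → F}
    (hX : g X = 0) (h : ∀ j ∈ H, X j = 0) : X p = 0 :=
  hg _ hr X 0 (by rw [hX, map_zero]) h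

/-- The kernel of a short linear code projects onto the source messages. -/
theorem exists_mem_ker_of_length_le (hg : IsIndexCode clients n ℓ g) (hℓ : ℓ ≤ n * 12)
    (s : Fin 7 → Fin n → F) :
    ∃ X ∈ LinearMap.ker g, ∀ i : Fin 7, X (i.castAdd 12) = s i := by
  let π : LinearMap.ker g →ₗ[F] (Fin 7 → Fin n → F) :=
    LinearMap.funLeft F (Fin n → F) (Fin.castAdd 12) ∘ₗ (LinearMap.ker g).subtype
  have hπ : Function.Injective π := by
    refine (injective_iff_map_eq_zero _).mpr fun X hX => ?_
    have hsource (i : Fin 7) : X.1 (i.castAdd 12) = 0 := congrFun hX i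
    refine Subtype.ext (funext fun p => ?_)
    induction p using Fin.addCases (m := 7) (n := 12) with
    | left i => exact hsource i
    | right e =>
      refine hg.eq_zero (H := {0, 1, 2, 3, 4, 5, 6}) ?_ X.2 ?_
      · simp [clients, edgeClients]
      · simp only [Finset.mem_insert, Finset.mem_singleton, forall_eq_or_imp, forall_eq]
        exact ⟨hsource 0, hsource 1, hsource 2, hsource 3, hsource 4, hsource 5, hsource 6⟩
  have hrank := g.finrank_range_add_finrank_ker
  have hrange := (LinearMap.range g).finrank_le
  have hker := LinearMap.finrank_le_finrank_of_injective hπ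
  simp only [Module.finrank_pi_fintype, Module.finrank_self, mul_one, Fintype.card_fin,
    Finset.sum_const, Finset.card_univ, smul_eq_mul] at hrank hrange hker
  obtain ⟨X, hX⟩ := (LinearMap.injective_iff_surjective_of_finrank_eq_finrank (f := π) (by
    simp only [Module.finrank_pi_fintype, Module.finrank_self, mul_one, Fintype.card_fin,
      Finset.sum_const, Finset.card_univ, smul_eq_mul]
    omega)).mp hπ s
  exact ⟨X.1, X.2, fun i => congrFun hX i⟩

theorem exists_kernel_of_fanoClients (hg : IsIndexCode clients n ℓ g) {b c w x y z : Fin 19}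
    (hsub : fanoClients b c w x y z ⊆ clients)
    (hsurj : ∀ s t r, ∃ X ∈ LinearMap.ker g, X 0 = s ∧ X b = t ∧ X c = r) (s : Fin n → F) :
    ∃ t r, ∀ X ∈ LinearMap.ker g, X 0 = s → X b = t → X c = r → X x = 0 ∧ X y = 0 ∧
      ∀ Y ∈ LinearMap.ker g, Y 0 = s + s → Y b = 0 → X w = Y w := by
  let v (p : Fin 19) : LinearMap.ker g →ₗ[F] (Fin n → F) :=
    LinearMap.proj p ∘ₗ (LinearMap.ker g).subtype
  have rel {p : Fin 19} {H : Finset (Fin 19)} (hr : (p, H) ∈ fanoClients b c w x y z)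
      (X : LinearMap.ker g) (h : ∀ j ∈ H, X.1 j = 0) : X.1 p = 0 :=
    hg.eq_zero (hsub hr) X.2 h
  obtain ⟨t, r, h⟩ := exists_kernel_of_fano_relations (a := v 0) (b := v b) (c := v c) (w := v w)
    (x := v x) (y := v y) (z := v z)
    (fun s t r => by
      obtain ⟨X, hX, h⟩ := hsurj s t r
      exact ⟨⟨X, hX⟩, h⟩)
    (fun X h₁ h₂ h₃ => rel (H := {z, 0, c}) (by simp [fanoClients]) X (by simp_all [v]))
    (fun X h₁ h₂ h₃ => rel (H := {z, 0, b}) (by simp [fanoClients]) X (by simp_all [v]))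
    (fun X h₁ h₂ => rel (H := {0, b}) (by simp [fanoClients]) X (by simp_all [v]))
    (fun X h₁ h₂ => rel (H := {0, c}) (by simp [fanoClients]) X (by simp_all [v]))
    (fun X h₁ h₂ => rel (H := {b, c}) (by simp [fanoClients]) X (by simp_all [v]))
    (fun X h₁ h₂ => rel (H := {z, c}) (by simp [fanoClients]) X (by simp_all [v]))
    (fun X h₁ h₂ => rel (H := {z, b}) (by simp [fanoClients]) X (by simp_all [v]))
    (fun X h₁ h₂ => rel (H := {z, 0}) (by simp [fanoClients]) X (by simp_all [v])) s
  refine ⟨t, r, fun X hX h₁ h₂ h₃ => ?_⟩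
  obtain ⟨hx, hy, hw⟩ := h ⟨X, hX⟩ h₁ h₂ h₃
  exact ⟨hx, hy, fun Y hY => hw ⟨Y, hY⟩⟩

theorem lt_length_of_linear (hn : 0 < n) (hg : IsIndexCode clients n ℓ g) : n * 12 < ℓ := by
  by_contra! hℓ
  have lift := exists_mem_ker_of_length_le hg hℓ
  have hone : (fun _ => 1 : Fin n → F) ≠ 0 := fun h => one_ne_zero (congrFun h ⟨0, hn⟩)
  by_cases h2 : (1 + 1 : F) = 0
  · obtain ⟨t, r, h⟩ := exists_kernel_of_fanoClients hg (b := 1) (c := 2) (w := 7) (x := 8)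
      (y := 9) (z := 10) (by decide +kernel) (fun s t r => by
        obtain ⟨X, hX, h⟩ := lift ![s, t, r, 0, 0, 0, 0]
        exact ⟨X, hX, h 0, h 1, h 2⟩) fun _ => 1
    obtain ⟨t', r', h'⟩ := exists_kernel_of_fanoClients hg (b := 3) (c := 4) (w := 11) (x := 12)
      (y := 13) (z := 14) (by decide +kernel) (fun s t r => by
        obtain ⟨X, hX, h⟩ := lift ![s, 0, 0, t, r, 0, 0]
        exact ⟨X, hX, h 0, h 3, h 4⟩) fun _ => 1
    obtain ⟨X, hX, hs⟩ := lift ![fun _ => 1, t, r, t', r', 0, 0]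
    obtain ⟨h8, h9, h7⟩ := h X hX (hs 0) (hs 1) (hs 2)
    obtain ⟨h12, h13, h11⟩ := h' X hX (hs 0) (hs 3) (hs 4)
    have hdouble : (0 : Fin n → F) = (fun _ => 1) + fun _ => 1 := funext fun _ => h2.symm
    have h7 := h7 0 (zero_mem _) hdouble rfl
    have h11 := h11 0 (zero_mem _) hdouble rfl
    refine hone ((hs 0).symm.trans
      (hg.eq_zero (p := 0) (H := {7, 8, 9, 11, 12, 13}) (by decide +kernel) hX ?_))
    simp only [Finset.mem_insert, Finset.mem_singleton, forall_eq_or_imp, forall_eq]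
    exact ⟨h7, h8, h9, h11, h12, h13⟩
  · obtain ⟨t, r, h⟩ := exists_kernel_of_fanoClients hg (b := 5) (c := 6) (w := 15) (x := 16)
      (y := 17) (z := 18) (by decide +kernel) (fun s t r => by
        obtain ⟨X, hX, h⟩ := lift ![s, 0, 0, 0, 0, t, r]
        exact ⟨X, hX, h 0, h 5, h 6⟩) fun _ => 1
    obtain ⟨X, hX, hs⟩ := lift ![fun _ => 1, 0, 0, 0, 0, t, r]
    obtain ⟨Y, hY, hu⟩ := lift ![(fun _ => 1) + fun _ => 1, 0, 0, 0, 0, 0, 0]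
    obtain ⟨h16, h17, h15⟩ := h X hX (hs 0) (hs 5) (hs 6)
    have hX15 : X 15 = 0 := hg.eq_zero (H := {16, 17}) (by decide +kernel) hX (by simp [h16, h17])
    have hY15 : Y 15 = 0 := (h15 Y hY (hu 0) (hu 5)).symm.trans hX15
    have hY5 : Y 5 = 0 := hu 5
    have hY0 : Y 0 = 0 := hg.eq_zero (H := {15, 5}) (by decide +kernel) hY (by simp [hY15, hY5])
    exact h2 (congrFun ((hu 0).symm.trans hY0) ⟨0, hn⟩)

end LinearCodes

/-- there exists an instance `I(X, R)` of the Index Coding problem such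
that (i) `I` has a (not necessarily linear) `(2, 4)` index code of length `2 · μ(I)`,
so `λ(2, 4) = μ(I)`; and (ii) for every finite field `F_q` (`q` a prime power) and
every positive block length `n`, every linear `(n, q)` index code for `I` has length
strictly greater than `n · μ(I)`.  Hence non-linear index codes strictly outperform
(vector) linear index codes over every field and every block length. -/
theorem index_coding_nonlinear_beats_linear :
    ∃ (k : ℕ) (R : Finset (Fin k × Finset (Fin k))),
      (∀ r ∈ R, r.1 ∉ r.2) ∧
      (∃ g : (Fin k → Fin 2 → Fin 4) → Fin (2 * mu R) → Fin 4,
        IsIndexCode R 2 (2 * mu R) g) ∧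
      (∀ (F : Type) [Field F] [Fintype F], ∀ n : ℕ, 0 < n → ∀ ℓ : ℕ,
        (∃ g : (Fin k → Fin n → F) → Fin ℓ → F,
          IsLinearMap F g ∧ IsIndexCode R n ℓ g) → n * mu R < ℓ) := by
  refine ⟨19, clients, clients_notMem, ?_, ?_⟩
  · rw [mu_clients]
    exact exists_isIndexCode_clients
  · rintro F _ _ n hn ℓ ⟨g, hlin, hg⟩
    rw [mu_clients]
    exact lt_length_of_linear (g := hlin.mk' g) hn hg
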